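/- Let s ≥ 1 and x ≥ 2 be integers and set h = x·s. For every w ∈ NC^A(s) and every block b of w, there is exactly one ρ_s-invariant element π of NC^A(h) such that F(π) = w and π possesses a block B with ρ_s(B) = B whose image under the reduction map i ↦ i mod s equals b. -/

import Mathlib

/-- `NCA m` is the set of noncrossing partitions of `{0, 1, …, m-1}` (modelled as `Fin m`). -/
def NCA (m : ℕ) : Set (Set (Set (Fin m))) :=
  {P | Setoid.IsPartition P ∧
    ∀ a b c d : Fin m, a < b → b < c → c < d →
      ∀ B ∈ P, ∀ B' ∈ P, B ≠ B' → a ∈ B → c ∈ B → b ∈ B' → d ∈ B' → False}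

/-- The rotation `ρ_t : i ↦ i + t (mod m)`. -/
def rot (m t : ℕ) (i : Fin m) : Fin m := ⟨(i.val + t) % m, Nat.mod_lt _ i.pos⟩

/-- A partition is invariant under `ρ_t` if the image of every block is again a block. -/
def RotInv (m t : ℕ) (P : Set (Set (Fin m))) : Prop := ∀ B ∈ P, rot m t '' B ∈ P

/-- The reduction map `{0,…,h-1} → {0,…,s-1}`, `i ↦ i mod s`. -/
def red (h s : ℕ) (hs : 0 < s) (i : Fin h) : Fin s := ⟨i.val % s, Nat.mod_lt _ hs⟩

/-- The map `F` sending a partition of `{0,…,h-1}` to the collection of images of its blocks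
under the reduction map. -/
def Fmap (h s : ℕ) (hs : 0 < s) (P : Set (Set (Fin h))) : Set (Set (Fin s)) :=
  (fun B => red h s hs '' B) '' P

/-- window index -/
def kk (s t i : ℕ) : ℕ := i / s + if i % s < t then 0 else 1

/-- same block of `w`, on naturals -/
def WW (s : ℕ) (w : Set (Set (Fin s))) (m n : ℕ) : Prop :=
  ∃ c ∈ w, ∃ (hm : m < s) (hn : n < s), (⟨m, hm⟩ : Fin s) ∈ c ∧ (⟨n, hn⟩ : Fin s) ∈ c

/-- the lifted relation -/
def EE (s x t : ℕ) (W : ℕ → ℕ → Prop) (i j : ℕ) : Prop :=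
  W (i % s) (j % s) ∧ (W t (i % s) ∨ kk s t i % x = kk s t j % x)

theorem mod_cases {x a b : ℕ} (ha : a ≤ x) (hb : b ≤ x) (h : a % x = b % x) :
    a = b ∨ (a = 0 ∧ b = x) ∨ (a = x ∧ b = 0) := by
  rcases Nat.lt_or_eq_of_le ha with ha | rfl
  · rcases Nat.lt_or_eq_of_le hb with hb | rfl
    · rw [Nat.mod_eq_of_lt ha, Nat.mod_eq_of_lt hb] at h; omega
    · rw [Nat.mod_eq_of_lt ha, Nat.mod_self] at h; omega
  · rcases Nat.lt_or_eq_of_le hb with hb | rfl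
    · rw [Nat.mod_eq_of_lt hb, Nat.mod_self] at h; omega
    · omega

theorem lex_of_lt {s a b : ℕ} (h : a < b) :
    a / s < b / s ∨ (a / s = b / s ∧ a % s < b % s) := by
  have h1 : a / s ≤ b / s := Nat.div_le_div_right h.le
  rcases Nat.lt_or_eq_of_le h1 with h1 | h1
  · exact Or.inl h1
  · right
    have e1 := Nat.div_add_mod a s
    have e2 := Nat.div_add_mod b s
    rw [h1] at e1
    exact ⟨h1, by omega⟩

set_option maxHeartbeats 4000000 in
theorem arith_core (x t qa qb qc qd a b c d ka kb kc kd : ℕ)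
    (hqd : qd < x)
    (ea : a < t ∧ ka = qa ∨ t ≤ a ∧ ka = qa + 1)
    (eb : b < t ∧ kb = qb ∨ t ≤ b ∧ kb = qb + 1)
    (ec : c < t ∧ kc = qc ∨ t ≤ c ∧ kc = qc + 1)
    (ed : d < t ∧ kd = qd ∨ t ≤ d ∧ kd = qd + 1)
    (hab : qa < qb ∨ qa = qb ∧ a < b)
    (hbc : qb < qc ∨ qb = qc ∧ b < c)
    (hcd : qc < qd ∨ qc = qd ∧ c < d)
    (key : ka = kb ∨ (ka = 0 ∧ kb = x))
    (k1 : ka = kc ∨ (ka = 0 ∧ kc = x))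
    (k2 : kb = kd ∨ (kb = 0 ∧ kd = x)) :
    (a < b ∧ b < c ∧ c < d) ∨ (b < c ∧ c < d ∧ d < a) ∨ (c < d ∧ d < a ∧ a < b) ∨
      (d < a ∧ a < b ∧ b < c) := by
  have hab' : a < b ∨ (t ≤ a ∧ b < t) ∨ (ka = 0 ∧ kb = x) := by
    clear hbc hcd k1 k2 ec ed; omega
  have hbc' : b < c ∨ (t ≤ b ∧ c < t) ∨ (kb = 0 ∧ kc = x) := by
    clear hab hcd ed hab'; omega
  have hcd' : c < d ∨ (t ≤ c ∧ d < t) ∨ (kc = 0 ∧ kd = x) := by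
    clear hab hbc hab' hbc'; omega
  rcases ea with ⟨ea, rfl⟩ | ⟨ea, rfl⟩ <;> rcases eb with ⟨eb, rfl⟩ | ⟨eb, rfl⟩ <;>
  rcases ec with ⟨ec, rfl⟩ | ⟨ec, rfl⟩ <;>
  rcases ed with ⟨ed, rfl⟩ | ⟨ed, rfl⟩ <;> omega

set_option maxHeartbeats 4000000 in
theorem cross_core (x t : ℕ) (W : ℕ → ℕ → Prop)
    (hsymm : ∀ a b, W a b → W b a) (htrans : ∀ a b c, W a b → W b c → W a c)
    (hmin : ∀ a, W t a → t ≤ a) 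
    (hnc : ∀ a b c d, a < b → b < c → c < d → W a c → W b d → W a b)
    (qa qb qc qd a b c d ka kb kc kd : ℕ)
    (hqd : qd < x) (tt : W t t)
    (ea : a < t ∧ ka = qa ∨ t ≤ a ∧ ka = qa + 1)
    (eb : b < t ∧ kb = qb ∨ t ≤ b ∧ kb = qb + 1)
    (ec : c < t ∧ kc = qc ∨ t ≤ c ∧ kc = qc + 1)
    (ed : d < t ∧ kd = qd ∨ t ≤ d ∧ kd = qd + 1)
    (hab : qa < qb ∨ qa = qb ∧ a < b)
    (hbc : qb < qc ∨ qb = qc ∧ b < c)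
    (hcd : qc < qd ∨ qc = qd ∧ c < d)
    (hac : W a c) (hbd : W b d)
    (h1 : W t a ∨ (ka = kc ∨ (ka = 0 ∧ kc = x) ∨ (ka = x ∧ kc = 0)))
    (h2 : W t b ∨ (kb = kd ∨ (kb = 0 ∧ kd = x) ∨ (kb = x ∧ kd = 0))) :
    W a b ∧ (W t a ∨ ka = kb ∨ (ka = 0 ∧ kb = x)) := by
  by_cases ta : W t a
  · have tc := htrans _ _ _ ta hac
    have := hmin _ ta
    have := hmin _ tc
    by_cases tb : W t b
    · exact ⟨htrans _ _ _ (hsymm _ _ ta) tb, Or.inl ta⟩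
    · exfalso
      have td : ¬ W t d := fun h => tb (htrans _ _ _ h (hsymm _ _ hbd))
      have nbt : b ≠ t := fun h => tb (h ▸ tt)
      have ndt : d ≠ t := fun h => td (h ▸ tt)
      have h2 := h2.resolve_left tb
      have key : kb = kd := by omega
      have A1 := hnc t b c d
      have A2 := hnc d t b c
      by_cases hb : t ≤ b
      · by_cases hd : t ≤ d
        · exact tb (A1 (by omega) (by omega) (by omega) tc hbd)
        · exact td (hsymm _ _ (A2 (by omega) (by omega) (by omega) (hsymm _ _ hbd) tc))
      · omega
  · have tc : ¬ W t c := fun h => ta (htrans _ _ _ h (hsymm _ _ hac))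
    have nat' : a ≠ t := fun h => ta (h ▸ tt)
    have nct : c ≠ t := fun h => tc (h ▸ tt)
    have h1 := h1.resolve_left ta
    by_cases tb : W t b
    · exfalso
      have td := htrans _ _ _ tb hbd
      have := hmin _ tb
      have := hmin _ td
      by_cases hk : ka = kc
      · have A1 := hnc t a b c
        have A2 := hnc c t a b
        by_cases ha : t ≤ a
        · by_cases hc : t ≤ c
          · exact ta (A1 (by omega) (by omega) (by omega) tb hac)
          · exact tc (hsymm _ _ (A2 (by omega) (by omega) (by omega) (hsymm _ _ hac) tb))
        · omega
      · exact ta (hsymm _ _ (hnc a t c d (by omega) (by omega) (by omega) hac td))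
    · have h2 := h2.resolve_left tb
      have td : ¬ W t d := fun h => tb (htrans _ _ _ h (hsymm _ _ hbd))
      have hca := hsymm _ _ hac
      have hdb := hsymm _ _ hbd
      have key : ka = kb ∨ (ka = 0 ∧ kb = x) := by omega
      have k1 : ka = kc ∨ (ka = 0 ∧ kc = x) := by omega
      have k2 : kb = kd ∨ (kb = 0 ∧ kd = x) := by omega
      have fin : W a b := by
        rcases arith_core x t qa qb qc qd a b c d ka kb kc kd hqd ea eb ec ed hab hbc hcd
          key k1 k2 with o1 | o2 | o3 | o4
        · exact hnc _ _ _ _ o1.1 o1.2.1 o1.2.2 hac hbd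
        · exact htrans _ _ _ hac (hsymm _ _ (hnc _ _ _ _ o2.1 o2.2.1 o2.2.2 hbd hca))
        · exact htrans _ _ _ hac (htrans _ _ _ (hnc _ _ _ _ o3.1 o3.2.1 o3.2.2 hca hdb) hdb)
        · exact hsymm _ _ (htrans _ _ _ hbd (hnc _ _ _ _ o4.1 o4.2.1 o4.2.2 hdb hac))
      exact ⟨fin, Or.inr key⟩

theorem kk_cases (s t i : ℕ) :
    i % s < t ∧ kk s t i = i / s ∨ t ≤ i % s ∧ kk s t i = i / s + 1 := by
  unfold kk
  split_ifs <;> omega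

theorem kk_le {s x t i : ℕ} (hi : i < x * s) : kk s t i ≤ x := by
  have h1 : i / s < x := Nat.div_lt_of_lt_mul (by rwa [mul_comm] at hi)
  rcases kk_cases s t i with h | h <;> omega

theorem EE_cross (s x t : ℕ) (W : ℕ → ℕ → Prop)
    (hsymm : ∀ a b, W a b → W b a) (htrans : ∀ a b c, W a b → W b c → W a c)
    (hmin : ∀ a, W t a → t ≤ a) 
    (hnc : ∀ a b c d, a < b → b < c → c < d → W a c → W b d → W a b) (tt : W t t)
    (a b c d : ℕ) (hab : a < b) (hbc : b < c) (hcd : c < d) (hd : d < x * s)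
    (hac : EE s x t W a c) (hbd : EE s x t W b d) : EE s x t W a b := by
  have hqd : d / s < x := Nat.div_lt_of_lt_mul (by rwa [mul_comm] at hd)
  have := cross_core x t W hsymm htrans hmin hnc (a/s) (b/s) (c/s) (d/s) (a%s) (b%s) (c%s) (d%s)
    _ _ _ _ hqd tt (kk_cases s t a) (kk_cases s t b) (kk_cases s t c) (kk_cases s t d)
    (lex_of_lt hab) (lex_of_lt hbc) (lex_of_lt hcd) hac.1 hbd.1
    (hac.2.imp_right (mod_cases (kk_le (by omega)) (kk_le (by omega))))
    (hbd.2.imp_right (mod_cases (kk_le (by omega)) (kk_le (by omega))))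
  refine ⟨this.1, this.2.imp_right ?_⟩
  rintro (h | ⟨h, h'⟩)
  · rw [h]
  · rw [h, h']; simp

theorem exists_lift (s x t m k : ℕ) (hx : 0 < x) (hm : m < s) :
    ∃ j, j < x * s ∧ j % s = m ∧ kk s t j % x = k % x := by
  have main : ∀ q, q < x → (q * s + m < x * s ∧ (q * s + m) % s = m ∧ (q * s + m) / s = q) := by
    intro q hq
    refine ⟨?_, ?_, ?_⟩
    · calc q * s + m < q * s + s := by omega
        _ = (q + 1) * s := by ring
        _ ≤ x * s := Nat.mul_le_mul_right _ hq
    · rw [mul_comm, Nat.mul_add_mod, Nat.mod_eq_of_lt hm]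
    · rw [mul_comm, Nat.mul_add_div (by omega), Nat.div_eq_of_lt hm]; rfl
  by_cases h : m < t
  · obtain ⟨h1, h2, h3⟩ := main (k % x) (Nat.mod_lt _ hx)
    refine ⟨_, h1, h2, ?_⟩
    unfold kk
    rw [h2, h3, if_pos h]; simp
  · obtain ⟨h1, h2, h3⟩ := main ((k + (x - 1)) % x) (Nat.mod_lt _ hx)
    refine ⟨_, h1, h2, ?_⟩
    unfold kk
    rw [h2, h3, if_neg h, Nat.mod_add_mod, show k + (x - 1) + 1 = k + x by omega]; simp

theorem lift_unique {s x t i j : ℕ} (hi : i < x * s) (hj : j < x * s) (h : i % s = j % s)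
    (hk : kk s t i % x = kk s t j % x) : i = j := by
  have h1 : i / s < x := Nat.div_lt_of_lt_mul (by rwa [mul_comm] at hi)
  have h2 : j / s < x := Nat.div_lt_of_lt_mul (by rwa [mul_comm] at hj)
  have e : i / s = j / s := by
    have hc := mod_cases (kk_le hi) (kk_le hj) hk
    clear hk hi hj
    have h5 := kk_cases s t i
    have h6 := kk_cases s t j
    rw [h] at h5
    generalize kk s t i = A at *
    generalize kk s t j = A' at *
    generalize i / s = q at *
    generalize j / s = q' at *
    generalize j % s = r at *
    omega
  rw [← Nat.div_add_mod i s, ← Nat.div_add_mod j s, e, h]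

theorem rot_val {s x t : ℕ} (hs : 0 < s) (i : ℕ) :
    (i + s) % (x * s) % s = i % s ∧ kk s t ((i + s) % (x * s)) % x = (kk s t i + 1) % x := by
  have h1 : (i + s) % (x * s) % s = i % s := by
    rw [Nat.mod_mul_left_mod, Nat.add_mod_right]
  refine ⟨h1, ?_⟩
  unfold kk
  rw [h1, Nat.mod_mul_left_div_self, Nat.add_div_right _ hs, Nat.mod_add_mod]
  congr 1; omega

theorem EE_rot {s x t : ℕ} (hs : 0 < s) (W : ℕ → ℕ → Prop) (i j : ℕ) :
    EE s x t W ((i + s) % (x * s)) ((j + s) % (x * s)) ↔ EE s x t W i j := by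
  unfold EE
  rw [(rot_val (t := t) hs i).1, (rot_val (t := t) hs j).1, (rot_val hs i).2, (rot_val hs j).2]
  have : (kk s t i + 1) % x = (kk s t j + 1) % x ↔ kk s t i % x = kk s t j % x :=
    ⟨fun h => Nat.ModEq.add_right_cancel' 1 h, fun h => Nat.ModEq.add_right 1 h⟩
  rw [this]

theorem rot_surj (h s : ℕ) : Function.Surjective (rot h s) := by
  rw [← Finite.injective_iff_surjective]
  intro i j hij
  have h1 : (i.val + s) % h = (j.val + s) % h := congrArg Fin.val hij
  have h2 : i.val % h = j.val % h := Nat.ModEq.add_right_cancel' s h1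
  rw [Nat.mod_eq_of_lt i.2, Nat.mod_eq_of_lt j.2] at h2
  exact Fin.ext h2

theorem block_eq {s : ℕ} {w : Set (Set (Fin s))} (hw : Setoid.IsPartition w)
    {c c' : Set (Fin s)} (hc : c ∈ w) (hc' : c' ∈ w) {m : Fin s} (h : m ∈ c) (h' : m ∈ c') :
    c = c' := (hw.2 m).unique ⟨hc, h⟩ ⟨hc', h'⟩

theorem WW_symm {s : ℕ} {w : Set (Set (Fin s))} (a b : ℕ) (h : WW s w a b) : WW s w b a := by
  obtain ⟨c, hc, h1, h2, h3, h4⟩ := h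
  exact ⟨c, hc, h2, h1, h4, h3⟩

theorem WW_trans {s : ℕ} {w : Set (Set (Fin s))} (hw : Setoid.IsPartition w) (a b c : ℕ)
    (h : WW s w a b) (h' : WW s w b c) : WW s w a c := by
  obtain ⟨B, hB, h1, h2, h3, h4⟩ := h
  obtain ⟨C, hC, g1, g2, g3, g4⟩ := h'
  obtain rfl := block_eq hw hB hC h4 g3
  exact ⟨B, hB, h1, g2, h3, g4⟩

theorem WW_refl {s : ℕ} {w : Set (Set (Fin s))} (hw : Setoid.IsPartition w) (a : ℕ) (ha : a < s) :
    WW s w a a := by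
  obtain ⟨B, ⟨hB, h⟩, -⟩ := hw.2 ⟨a, ha⟩
  exact ⟨B, hB, ha, ha, h, h⟩

theorem WW_nc {s : ℕ} {w : Set (Set (Fin s))} (hw : w ∈ NCA s) (a b c d : ℕ)
    (hab : a < b) (hbc : b < c) (hcd : c < d) (hac : WW s w a c) (hbd : WW s w b d) :
    WW s w a b := by
  obtain ⟨B, hB, h1, h2, h3, h4⟩ := hac
  obtain ⟨C, hC, g1, g2, g3, g4⟩ := hbd
  by_cases hne : B = C
  · subst hne
    exact ⟨B, hB, h1, g1, h3, g3⟩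
  · exact (hw.2 ⟨a, h1⟩ ⟨b, g1⟩ ⟨c, h2⟩ ⟨d, g2⟩ hab hbc hcd B hB C hC hne h3 h4 g3 g4).elim

theorem WW_mem {s : ℕ} {w : Set (Set (Fin s))} (hw : Setoid.IsPartition w) {c : Set (Fin s)}
    (hc : c ∈ w) {m : Fin s} (hm : m ∈ c) (n : Fin s) : WW s w m n ↔ n ∈ c := by
  constructor
  · rintro ⟨B, hB, h1, h2, h3, h4⟩
    obtain rfl := block_eq hw hB hc h3 hm
    exact h4
  · intro h
    exact ⟨c, hc, m.2, n.2, hm, h⟩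

/-- The lifted setoid. -/
def lifted (s x t h : ℕ) (W : ℕ → ℕ → Prop) (hs : 0 < s)
    (hrefl : ∀ a, a < s → W a a)
    (hsymm : ∀ a b, W a b → W b a) (htrans : ∀ a b c, W a b → W b c → W a c) :
    Setoid (Fin h) where
  r i j := EE s x t W i j
  iseqv :=
    { refl := fun i => ⟨hrefl _ (Nat.mod_lt _ hs), Or.inr rfl⟩
      symm := by
        rintro i j ⟨h1, h2⟩
        exact ⟨hsymm _ _ h1, h2.imp (fun h => htrans _ _ _ h h1) Eq.symm⟩
      trans := by
        rintro i j k ⟨h1, h2⟩ ⟨h3, h4⟩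
        refine ⟨htrans _ _ _ h1 h3, ?_⟩
        rcases h2 with h2 | h2
        · exact Or.inl h2
        · rcases h4 with h4 | h4
          · exact Or.inl (htrans _ _ _ h4 (hsymm _ _ h1))
          · exact Or.inr (h2.trans h4) }

/-- Crossing argument: a block disjoint from the big block lies in one window. -/
theorem same_window {s x t : ℕ} (hx : 2 ≤ x) (ht : t < s) {i j : ℕ} (hij : i < j) (hj : j < x * s)
    (hi' : i % s ≠ t) (hj' : j % s ≠ t) (hne : kk s t i % x ≠ kk s t j % x) :
    ∃ u v, u < x * s ∧ v < x * s ∧ u % s = t ∧ v % s = t ∧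
      ((u < i ∧ i < v ∧ v < j) ∨ (i < v ∧ v < j ∧ j < u)) := by
  have hs : 0 < s := by omega
  have hqi : i / s < x := Nat.div_lt_of_lt_mul (by rw [mul_comm]; omega)
  have hqj : j / s < x := Nat.div_lt_of_lt_mul (by rwa [mul_comm] at hj)
  have main : ∀ q, q < x → (q * s + t < x * s ∧ (q * s + t) % s = t) := by
    intro q hq
    refine ⟨?_, ?_⟩
    · calc q * s + t < q * s + s := by omega
        _ = (q + 1) * s := by ring
        _ ≤ x * s := Nat.mul_le_mul_right _ hq
    · rw [mul_comm, Nat.mul_add_mod, Nat.mod_eq_of_lt ht]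
  have ei := Nat.div_add_mod i s
  have ej := Nat.div_add_mod j s
  have mi := Nat.mod_lt i hs
  have mj := Nat.mod_lt j hs
  have lt1 : ∀ q, i < q * s + t ↔ kk s t i ≤ q := by
    intro q
    constructor
    · intro h
      by_contra hc
      have hc' : q ≤ i / s := by rcases kk_cases s t i with h3 | h3 <;> omega
      rcases Nat.lt_or_eq_of_le hc' with h5 | h5
      · have := Nat.mul_le_mul_left s (Nat.succ_le_of_lt h5)
        rw [Nat.mul_succ, mul_comm s q] at this
        omega
      · rw [← h5, mul_comm s q] at ei
        rcases kk_cases s t i with h3 | h3 <;> omega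
    · intro h
      rcases kk_cases s t i with h3 | h3
      · have : s * (i / s) ≤ s * q := Nat.mul_le_mul_left s (by omega)
        rw [mul_comm s q] at this
        omega
      · have : s * (i / s + 1) ≤ s * q := Nat.mul_le_mul_left s (by omega)
        rw [mul_comm s q, Nat.mul_succ] at this
        omega
  have lt2 : ∀ q, q < kk s t j → q * s + t < j := by
    intro q h
    rcases kk_cases s t j with h3 | h3
    · have : s * (q + 1) ≤ s * (j / s) := Nat.mul_le_mul_left s (by omega)
      rw [Nat.mul_succ, mul_comm s q] at this
      omega
    · have : s * q ≤ s * (j / s) := Nat.mul_le_mul_left s (by omega)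
      rw [mul_comm s q] at this
      omega
  have lt3 : ∀ q, q < kk s t i → q * s + t < i := by
    intro q h
    have h1 := lt1 q
    have h2 : i ≠ q * s + t := by
      intro h
      rw [h, mul_comm, Nat.mul_add_mod, Nat.mod_eq_of_lt ht] at hi'
      exact hi' rfl
    omega
  have lt4 : ∀ q, kk s t j ≤ q → j < q * s + t := by
    intro q h
    rcases kk_cases s t j with h3 | h3
    · have : s * (j / s) ≤ s * q := Nat.mul_le_mul_left s (by omega)
      rw [mul_comm s q] at this
      omega
    · have : s * (j / s + 1) ≤ s * q := Nat.mul_le_mul_left s (by omega)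
      rw [mul_comm s q, Nat.mul_succ] at this
      omega
  have hle : kk s t i < kk s t j := by
    have hne' : kk s t i ≠ kk s t j := fun h => hne (by rw [h])
    have := lex_of_lt (s := s) hij
    rcases kk_cases s t i with h3 | h3 <;> rcases kk_cases s t j with h4 | h4 <;> omega
  have kj := kk_le (t := t) hj
  have hv := main (kk s t i) (by omega)
  by_cases h0 : kk s t i = 0
  · have hjx : kk s t j < x := by
      rcases Nat.lt_or_eq_of_le kj with h | h
      · exact h
      · rw [h0, h] at hne; simp at hne
    have hu := main (kk s t j) hjx
    exact ⟨_, _, hu.1, hv.1, hu.2, hv.2, Or.inr ⟨(lt1 _).2 le_rfl, lt2 _ hle, lt4 _ le_rfl⟩⟩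
  · have hu := main 0 (by omega)
    exact ⟨_, _, hu.1, hv.1, hu.2, hv.2, Or.inl ⟨lt3 _ (by omega), (lt1 _).2 le_rfl, lt2 _ hle⟩⟩

theorem rot_mem_of_inv {s x : ℕ} (hs : 0 < s) {B : Set (Fin (x * s))}
    (hB : rot (x * s) s '' B = B) {i j : Fin (x * s)} (hi : i ∈ B)
    (hij : i.val % s = j.val % s) : j ∈ B := by
  have step : ∀ n : ℕ, ∀ k : Fin (x * s), k.val = (i.val + n * s) % (x * s) → k ∈ B := by
    intro n
    induction n with
    | zero =>
      intro k hk
      rw [Nat.zero_mul, Nat.add_zero, Nat.mod_eq_of_lt i.2] at hk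
      rwa [Fin.ext hk]
    | succ n ih =>
      intro k hk
      rw [← hB]
      refine ⟨⟨(i.val + n * s) % (x * s), Nat.mod_lt _ i.pos⟩, ih _ rfl, ?_⟩
      apply Fin.ext
      rw [hk]
      simp only [rot]
      rw [Nat.mod_add_mod]
      congr 1; ring
  have ei := Nat.div_add_mod i.val s
  have ej := Nat.div_add_mod j.val s
  have hqi : i.val / s < x := Nat.div_lt_of_lt_mul (lt_of_lt_of_eq i.2 (mul_comm _ _))
  apply step (j.val / s + (x - i.val / s))
  have : i.val + (j.val / s + (x - i.val / s)) * s = j.val + x * s := by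
    obtain ⟨d, hd⟩ := Nat.exists_eq_add_of_lt hqi
    have : x - i.val / s = d + 1 := by omega
    rw [this]
    have h2 : x * s = (i.val / s) * s + (d + 1) * s := by rw [← Nat.add_mul]; congr 1
    have h3 := mul_comm s (i.val / s)
    have h4 := mul_comm s (j.val / s)
    have h5 := Nat.add_mul (j.val / s) (d + 1) s
    omega
  rw [this, Nat.add_mod_right, Nat.mod_eq_of_lt j.2]

/-- Let `s ≥ 1`, `x ≥ 2`, `h = x·s`. For every `w ∈ NC^A(s)` and every block `b` of `w`,
there is exactly one `ρ_s`-invariant `π ∈ NC^A(h)` with `F(π) = w` possessing a block `B`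
with `ρ_s(B) = B` whose image under the reduction map equals `b`. -/
theorem unique_invariant_partition_with_big_block
    (s x h : ℕ) (hs : 0 < s) (hx : 2 ≤ x) (hh : h = x * s)
    (w : Set (Set (Fin s))) (hw : w ∈ NCA s) (b : Set (Fin s)) (hb : b ∈ w) :
    ∃! π : Set (Set (Fin h)), π ∈ NCA h ∧ RotInv h s π ∧ Fmap h s hs π = w ∧
      ∃ B ∈ π, rot h s '' B = B ∧ red h s hs '' B = b := by
  subst hh
  have hwp := hw.1
  have hbne : b.Nonempty := by
    rw [Set.nonempty_iff_ne_empty]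
    rintro rfl
    exact hwp.1 hb
  obtain ⟨t, htb, htmin⟩ := Set.exists_min_image b id (Set.toFinite b) hbne
  have hxpos : 0 < x := by omega
  have tt : WW s w t t := WW_refl hwp _ t.2
  have hmin : ∀ a, WW s w t a → t.val ≤ a := by
    rintro a h
    have ha : a < s := by obtain ⟨c, hc, h1, h2, h3, h4⟩ := h; exact h2
    exact htmin ⟨a, ha⟩ ((WW_mem hwp hb htb ⟨a, ha⟩).1 h)
  let S : Setoid (Fin (x * s)) := lifted s x t (x * s) (WW s w) hs (WW_refl hwp) WW_symm
    (WW_trans hwp)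
  have hS : ∀ i j, S i j ↔ EE s x t (WW s w) i j := fun i j => Iff.rfl
  have redW : ∀ i j : Fin (x * s), WW s w (i.val % s) (j.val % s) ↔
      ∃ c ∈ w, red (x * s) s hs i ∈ c ∧ red (x * s) s hs j ∈ c := by
    intro i j
    constructor
    · rintro ⟨c, hc, h1, h2, h3, h4⟩
      exact ⟨c, hc, h3, h4⟩
    · rintro ⟨c, hc, h3, h4⟩
      exact ⟨c, hc, Nat.mod_lt _ hs, Nat.mod_lt _ hs, h3, h4⟩
  have tred : ∀ i : Fin (x * s), WW s w t (i.val % s) ↔ red (x * s) s hs i ∈ b := fun i =>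
    WW_mem hwp hb htb (red (x * s) s hs i)
  have hrotcls : ∀ i, rot (x * s) s '' {j | S j i} = {j | S j (rot (x * s) s i)} := by
    intro i
    ext j
    constructor
    · rintro ⟨k, hk, rfl⟩
      exact (EE_rot hs (WW s w) k i).2 hk
    · intro hj
      obtain ⟨k, rfl⟩ := rot_surj (x * s) s j
      exact ⟨k, (EE_rot hs (WW s w) k i).1 hj, rfl⟩
  have hredcls : ∀ i, ∀ c ∈ w, red (x * s) s hs i ∈ c → red (x * s) s hs '' {j | S j i} = c := by
    intro i c hc hic
    ext m
    constructor
    · rintro ⟨k, hk, rfl⟩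
      exact (WW_mem hwp hc hic _).1 (WW_symm _ _ hk.1)
    · intro hm
      obtain ⟨j, hj1, hj2, hj3⟩ := exists_lift s x t m (kk s t i) hxpos m.2
      have : red (x * s) s hs ⟨j, hj1⟩ = m := Fin.ext hj2
      refine ⟨⟨j, hj1⟩, ⟨?_, Or.inr hj3⟩, this⟩
      exact (redW ⟨j, hj1⟩ i).2 ⟨c, hc, by rw [this]; exact hm, hic⟩
  refine ⟨S.classes, ⟨⟨Setoid.isPartition_classes S, ?_⟩, ?_, ?_, ?_⟩, ?_⟩
  · rintro i j k l hij hjk hkl B ⟨y, rfl⟩ B' ⟨z, rfl⟩ hne hi hk hj hl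
    have h1 : S i k := S.trans hi (S.symm hk)
    have h2 : S j l := S.trans hj (S.symm hl)
    have h3 : S i j := EE_cross s x t (WW s w) WW_symm (WW_trans hwp) hmin (WW_nc hw) tt
      i j k l hij hjk hkl l.2 h1 h2
    apply hne
    have h4 : S y z := S.trans (S.symm hi) (S.trans h3 hj)
    ext u
    exact ⟨fun h => S.trans h h4, fun h => S.trans h (S.symm h4)⟩
  · rintro B ⟨y, rfl⟩
    rw [hrotcls]
    exact ⟨_, rfl⟩
  · ext c
    constructor
    · rintro ⟨B, ⟨y, rfl⟩, rfl⟩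
      obtain ⟨c, ⟨hc, hyc⟩, -⟩ := hwp.2 (red (x * s) s hs y)
      simp only
      rw [hredcls y c hc hyc]
      exact hc
    · intro hc
      have hcne : c.Nonempty := by
        rw [Set.nonempty_iff_ne_empty]
        rintro rfl
        exact hwp.1 hc
      obtain ⟨m, hm⟩ := hcne
      obtain ⟨j, hj1, hj2, hj3⟩ := exists_lift s x t m 0 hxpos m.2
      have : red (x * s) s hs ⟨j, hj1⟩ = m := Fin.ext hj2
      exact ⟨_, ⟨⟨j, hj1⟩, rfl⟩, hredcls _ c hc (by rw [this]; exact hm)⟩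
  · obtain ⟨j, hj1, hj2, hj3⟩ := exists_lift s x t t 0 hxpos t.2
    have ht : red (x * s) s hs ⟨j, hj1⟩ = t := Fin.ext hj2
    refine ⟨_, ⟨⟨j, hj1⟩, rfl⟩, ?_, hredcls _ b hb (by rw [ht]; exact htb)⟩
    rw [hrotcls]
    have h4 : S (rot (x * s) s ⟨j, hj1⟩) ⟨j, hj1⟩ := by
      have h5 : (rot (x * s) s ⟨j, hj1⟩).val % s = t := by
        rw [← hj2]; exact (rot_val (t := 0) hs j).1
      rw [hS]
      unfold EE
      rw [h5]
      simp only [hj2]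
      exact ⟨tt, Or.inl tt⟩
    ext u
    exact ⟨fun h => S.trans h h4, fun h => S.trans h (S.symm h4)⟩
  · rintro π ⟨⟨hp, hnc⟩, -, hF, B, hB, hBrot, hBred⟩
    have memB : ∀ i, i ∈ B ↔ red (x * s) s hs i ∈ b := by
      intro i
      constructor
      · intro h
        rw [← hBred]
        exact ⟨i, h, rfl⟩
      · intro h
        rw [← hBred] at h
        obtain ⟨j, hj, hji⟩ := h
        exact rot_mem_of_inv hs hBrot hj (congrArg Fin.val hji)
    have uniq : ∀ C ∈ π, ∀ C' ∈ π, ∀ m, m ∈ C → m ∈ C' → C = C' := fun C hC C' hC' m h h' =>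
      (hp.2 m).unique ⟨hC, h⟩ ⟨hC', h'⟩
    have hFC : ∀ C ∈ π, red (x * s) s hs '' C ∈ w := by
      intro C hC
      rw [← hF]
      exact ⟨C, hC, rfl⟩
    have window : ∀ C ∈ π, C ≠ B → ∀ i ∈ C, ∀ j ∈ C, i < j →
        kk s t i % x = kk s t j % x := by
      intro C hC hCB i hi j hj hij
      by_contra hne
      have hnt : ∀ i ∈ C, i.val % s ≠ t := by
        intro i hi h
        apply hCB
        refine uniq C hC B hB i hi ((memB i).2 ?_)
        have : red (x * s) s hs i = t := Fin.ext h
        rw [this]; exact htb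
      obtain ⟨u, v, hu, hv, hut, hvt, hor⟩ := same_window hx t.2 hij j.2 (hnt i hi) (hnt j hj) hne
      have huB : (⟨u, hu⟩ : Fin (x * s)) ∈ B := by
        rw [memB]
        have : red (x * s) s hs ⟨u, hu⟩ = t := Fin.ext hut
        rw [this]; exact htb
      have hvB : (⟨v, hv⟩ : Fin (x * s)) ∈ B := by
        rw [memB]
        have : red (x * s) s hs ⟨v, hv⟩ = t := Fin.ext hvt
        rw [this]; exact htb
      rcases hor with ⟨h1, h2, h3⟩ | ⟨h1, h2, h3⟩
      · exact hnc ⟨u, hu⟩ i ⟨v, hv⟩ j h1 h2 h3 B hB C hC hCB.symm huB hvB hi hj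
      · exact hnc i ⟨v, hv⟩ j ⟨u, hu⟩ h1 h2 h3 C hC B hB hCB hi hj hvB huB
    have fwd : ∀ C ∈ π, ∀ i ∈ C, ∀ j ∈ C, S i j := by
      intro C hC i hi j hj
      refine ⟨(redW i j).2 ⟨_, hFC C hC, ⟨i, hi, rfl⟩, ⟨j, hj, rfl⟩⟩, ?_⟩
      by_cases hCB : C = B
      · left
        rw [tred, ← memB, ← hCB]
        exact hi
      · right
        rcases lt_trichotomy i j with h | h | h
        · exact window C hC hCB i hi j hj h
        · rw [h]
        · exact (window C hC hCB j hj i hi h).symm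
    have cls : ∀ C ∈ π, ∀ i ∈ C, C = {j | S j i} := by
      intro C hC i hi
      ext j
      constructor
      · intro hj
        exact fwd C hC j hj i hi
      · rintro ⟨h1, h2⟩
        rcases h2 with h2 | h2
        · have hjB : j ∈ B := (memB j).2 ((tred j).1 h2)
          have hiB : i ∈ B := (memB i).2 ((tred i).1 (WW_trans hwp _ _ _ h2 h1))
          rw [uniq C hC B hB i hi hiB]
          exact hjB
        · have hj' : red (x * s) s hs j ∈ red (x * s) s hs '' C :=
            (WW_mem hwp (hFC C hC) ⟨i, hi, rfl⟩ (red (x * s) s hs j)).1 (WW_symm _ _ h1)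
          obtain ⟨k, hk, hkj⟩ := hj'
          have hkj' : k.val % s = j.val % s := congrArg Fin.val hkj
          rcases (fwd C hC k hk i hi).2 with h5 | h5
          · have hkB : k ∈ B := (memB k).2 ((tred k).1 h5)
            rw [uniq C hC B hB k hk hkB, memB, ← hkj, ← memB]
            exact hkB
          · have : k = j := Fin.ext (lift_unique k.2 j.2 hkj' (h5.trans h2.symm))
            rw [← this]; exact hk
    ext C
    constructor
    · intro hC
      have hne : C.Nonempty := by
        rw [Set.nonempty_iff_ne_empty]
        rintro rfl
        exact hp.1 hC
      obtain ⟨i, hi⟩ := hne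
      exact ⟨i, cls C hC i hi⟩
    · rintro ⟨i, rfl⟩
      obtain ⟨C, ⟨hC, hi⟩, -⟩ := hp.2 i
      rw [← cls C hC i hi]
      exact hC
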